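/- Let N ≥ 1 be an integer, p > 1, and T ∈ (0,∞). There exists a constant C > 0 depending only on N and p such that: if μ is a nonnegative Radon measure on ℝ^N and there exists a very weak supersolution u of ∂_t u − Δu = u^p with initial data μ on ℝ^N × [0,T), then for every τ ∈ (0,T) and every nonnegative smooth compactly supported φ : ℝ^N × [0,τ] → ℝ with φ(·,τ) = 0, one has ∫_{ℝ^N} φ(x,0)^{p/(p−1)} dμ(x) ≤ C ∫∫_{supp φ} |−∂_t φ(x,t) − Δφ(·,t)(x)|^{p/(p−1)} dx dt, where the right-hand integral is taken over the support of φ. -/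

import Mathlib

open MeasureTheory Real Set

/-- The Euclidean Laplacian `Δφ(x) = Σ_i ∂²φ/∂x_i²(x)` of `φ : ℝ^N → ℝ`. -/
noncomputable def euclLap (N : ℕ) (φ : EuclideanSpace ℝ (Fin N) → ℝ)
    (x : EuclideanSpace ℝ (Fin N)) : ℝ :=
  ∑ i : Fin N,
    iteratedFDeriv ℝ 2 φ x ![EuclideanSpace.single i 1, EuclideanSpace.single i 1]

/-- `u` is a very weak supersolution of `∂_t u - Δ u = u^p` with initial data `μ`
on `ℝ^N × [0,T)`. -/
def IsVeryWeakSupersolutionHeat (N : ℕ) (p T : ℝ)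
    (μ : Measure (EuclideanSpace ℝ (Fin N)))
    (u : EuclideanSpace ℝ (Fin N) → ℝ → ℝ) : Prop :=
  Measurable (Function.uncurry u) ∧
  (∀ x : EuclideanSpace ℝ (Fin N), ∀ t ∈ Set.Ioo (0:ℝ) T, 0 ≤ u x t) ∧
  (∀ K : Set (EuclideanSpace ℝ (Fin N)), IsCompact K → ∀ T' ∈ Set.Ioo (0:ℝ) T,
    IntegrableOn (Function.uncurry u) (K ×ˢ Set.Ioo (0:ℝ) T') ∧
    IntegrableOn (fun q : EuclideanSpace ℝ (Fin N) × ℝ => u q.1 q.2 ^ p)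
      (K ×ˢ Set.Ioo (0:ℝ) T')) ∧
  ∀ τ ∈ Set.Ioo (0:ℝ) T, ∀ φ : EuclideanSpace ℝ (Fin N) → ℝ → ℝ,
    ContDiff ℝ (⊤ : ℕ∞) (Function.uncurry φ) →
    HasCompactSupport (Function.uncurry φ) →
    (∀ x t, 0 ≤ φ x t) →
    (∀ x, φ x τ = 0) →
    (∫ t in Set.Ioo (0:ℝ) τ, ∫ x,
        u x t * (-(deriv (φ x) t) - euclLap N (fun y => φ y t) x)) ≥
      (∫ t in Set.Ioo (0:ℝ) τ, ∫ x, u x t ^ p * φ x t) + ∫ x, φ x 0 ∂μ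


noncomputable def FF (q ε s : ℝ) : ℝ := (s+ε)^q * expNegInvGlue (s/(2*q*ε))

lemma FF_nonpos {q ε s : ℝ} (hq : 1 < q) (hε : 0 < ε) (hs : s ≤ 0) : FF q ε s = 0 := by
  unfold FF
  rw [expNegInvGlue.zero_of_nonpos, mul_zero]
  exact div_nonpos_of_nonpos_of_nonneg hs (by positivity)

lemma FF_pos {q ε s : ℝ} (hq : 1 < q) (hε : 0 < ε) (hs : 0 < s) :
    FF q ε s = (s+ε)^q * exp (-(2*q*ε/s)) := by
  unfold FF expNegInvGlue
  rw [if_neg (not_le.2 (by positivity)), inv_div]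

lemma FF_nonneg {q ε : ℝ} (hq : 1 < q) (hε : 0 < ε) (s : ℝ) : 0 ≤ FF q ε s := by
  rcases le_or_gt s 0 with hs | hs
  · rw [FF_nonpos hq hε hs]
  · rw [FF_pos hq hε hs]; positivity

lemma FF_contDiff {q ε : ℝ} (hq : 1 < q) (hε : 0 < ε) : ContDiff ℝ (⊤ : ℕ∞) (FF q ε) := by
  rw [contDiff_iff_contDiffAt]
  intro s
  rcases lt_or_ge s 0 with hs | hs
  · have : FF q ε =ᶠ[nhds s] fun _ => 0 := by
      filter_upwards [Iio_mem_nhds hs] with y hy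
      exact FF_nonpos hq hε (le_of_lt hy)
    exact contDiffAt_const.congr_of_eventuallyEq this
  · unfold FF
    refine ContDiffAt.mul ?_ ?_
    · exact (contDiffAt_id.add contDiffAt_const).rpow_const_of_ne (by simp; linarith)
    · exact expNegInvGlue.contDiff.contDiffAt.comp s (contDiffAt_id.div_const _)

lemma FF_hasDeriv {q ε s : ℝ} (hq : 1 < q) (hε : 0 < ε) (hs : 0 < s) :
    HasDerivAt (FF q ε) (FF q ε s * (q * (1/(s+ε) + 2*ε/s^2))) s := by
  have h1 : HasDerivAt (fun s : ℝ => (s+ε)^q * exp (-(2*q*ε/s)))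
      (FF q ε s * (q * (1/(s+ε) + 2*ε/s^2))) s := by
    have a1 : HasDerivAt (fun s : ℝ => (s+ε)^q) (1 * q * (s+ε)^(q-1)) s :=
      ((hasDerivAt_id s).add_const ε).rpow_const (Or.inl (by simp; linarith))
    have a2 : HasDerivAt (fun s : ℝ => exp (-(2*q*ε/s)))
        (exp (-(2*q*ε/s)) * (-((0 * s - (2*q*ε) * 1)/s^2))) s :=
      (((hasDerivAt_const s (2*q*ε)).div (hasDerivAt_id s) hs.ne').neg).exp
    refine (a1.mul a2).congr_deriv ?_
    rw [FF_pos hq hε hs, rpow_sub_one (by linarith : s + ε ≠ 0)]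
    have : s + ε ≠ 0 := by positivity
    field_simp
    ring
  refine h1.congr_of_eventuallyEq ?_
  filter_upwards [Ioi_mem_nhds hs] with y hy
  exact FF_pos hq hε hy

lemma FF_deriv_nonpos {q ε s : ℝ} (hq : 1 < q) (hε : 0 < ε) (hs : s ≤ 0) :
    deriv (FF q ε) s = 0 := by
  rcases lt_or_eq_of_le hs with hs | rfl
  · have : FF q ε =ᶠ[nhds s] fun _ => 0 := by
      filter_upwards [Iio_mem_nhds hs] with y hy
      exact FF_nonpos hq hε (le_of_lt hy)
    rw [this.deriv_eq]; simp
  · apply IsLocalMin.deriv_eq_zero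
    refine Filter.Eventually.of_forall fun y => ?_
    rw [FF_nonpos hq hε le_rfl]; exact FF_nonneg hq hε y

lemma FF_deriv_nonneg {q ε : ℝ} (hq : 1 < q) (hε : 0 < ε) (s : ℝ) :
    0 ≤ deriv (FF q ε) s := by
  rcases le_or_gt s 0 with hs | hs
  · rw [FF_deriv_nonpos hq hε hs]
  · rw [(FF_hasDeriv hq hε hs).deriv]
    have := FF_nonneg hq hε s
    positivity

lemma FF_deriv2 {q ε : ℝ} (hq : 1 < q) (hε : 0 < ε) (s : ℝ) :
    0 ≤ deriv (deriv (FF q ε)) s := by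
  rcases lt_trichotomy s 0 with hs | rfl | hs
  · have : deriv (FF q ε) =ᶠ[nhds s] fun _ => 0 := by
      filter_upwards [Iio_mem_nhds hs] with y hy
      exact FF_deriv_nonpos hq hε (le_of_lt hy)
    rw [this.deriv_eq]; simp
  · apply le_of_eq
    symm
    apply IsLocalMin.deriv_eq_zero
    refine Filter.Eventually.of_forall fun y => ?_
    rw [FF_deriv_nonpos hq hε le_rfl]; exact FF_deriv_nonneg hq hε y
  · have e : deriv (FF q ε) =ᶠ[nhds s] fun s => FF q ε s * (q * (1/(s+ε) + 2*ε/s^2)) := by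
      filter_upwards [Ioi_mem_nhds hs] with y hy
      exact (FF_hasDeriv hq hε hy).deriv
    rw [e.deriv_eq]
    have hse : 0 < s + ε := by positivity
    have b1 : HasDerivAt (fun s : ℝ => 1/(s+ε)) ((0*(s+ε) - 1*1)/(s+ε)^2) s :=
      (hasDerivAt_const s (1:ℝ)).div ((hasDerivAt_id s).add_const ε) hse.ne'
    have b2 : HasDerivAt (fun s : ℝ => 2*ε/s^2) ((0*(s^2) - (2*ε)*(((2:ℕ):ℝ)*s^(2-1)))/(s^2)^2) s :=
      (hasDerivAt_const s (2*ε)).div (hasDerivAt_pow 2 s) (by positivity)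
    have := ((FF_hasDeriv hq hε hs).mul ((b1.add b2).const_mul q)).deriv
    have key : deriv (fun s => FF q ε s * (q * (1/(s+ε) + 2*ε/s^2))) s = _ := this
    rw [key]
    have h0 := FF_nonneg hq hε s
    have : 0 ≤ (1/(s+ε) + 2*ε/s^2)^2 - 1/(s+ε)^2 - 4*ε/s^3 := by
      have : (1/(s+ε) + 2*ε/s^2)^2 - 1/(s+ε)^2 - 4*ε/s^3 = 4*ε^3/(s^4*(s+ε)) := by
        field_simp
        ring
      rw [this]; positivity
    have h2 : 0 ≤ (q-1) * (1/(s+ε) + 2*ε/s^2)^2 := mul_nonneg (by linarith) (sq_nonneg _)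
    have h3 : 0 ≤ FF q ε s * q * (((1/(s+ε) + 2*ε/s^2)^2 - 1/(s+ε)^2 - 4*ε/s^3)
      + (q-1) * (1/(s+ε) + 2*ε/s^2)^2) := by positivity
    convert h3 using 1
    simp only [Pi.add_apply]
    field_simp
    push_cast
    ring

lemma FF_le {q ε s : ℝ} (hq : 1 < q) (hε : 0 < ε) (hs : 0 ≤ s) : FF q ε s ≤ s ^ q := by
  rcases le_or_gt s 0 with h | hs
  · rw [FF_nonpos hq hε h]; positivity
  · rw [FF_pos hq hε hs]
    have : exp (-(2*q*ε/s)) = (exp (-(2*ε/s)))^q := by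
      rw [← exp_mul]; congr 1; ring
    rw [this, ← mul_rpow (by positivity) (by positivity)]
    apply rpow_le_rpow (by positivity) _ (by linarith)
    rw [exp_neg, mul_inv_le_iff₀ (exp_pos _)]
    have h1 := add_one_le_exp (2*ε/s)
    have h2 : s + ε ≤ s * (2*ε/s+1) := by field_simp; linarith
    exact h2.trans (by gcongr)

lemma FF_deriv_le {q ε : ℝ} (hq : 1 < q) (hε : 0 < ε) (s : ℝ) :
    deriv (FF q ε) s ≤ q * (FF q ε s) ^ (1 - 1/q) := by
  rcases le_or_gt s 0 with hs | hs
  · rw [FF_deriv_nonpos hq hε hs]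
    have := FF_nonneg hq hε s
    positivity
  · rw [(FF_hasDeriv hq hε hs).deriv]
    have hse : 0 < s + ε := by positivity
    have hF : 0 < FF q ε s := by rw [FF_pos hq hε hs]; positivity
    have e1 : FF q ε s ^ (1/q) = (s+ε) * exp (-(2*ε/s)) := by
      have : exp (-(2*q*ε/s)) = (exp (-(2*ε/s)))^q := by
        rw [← exp_mul]; congr 1; ring
      rw [FF_pos hq hε hs, this, ← mul_rpow (by positivity) (by positivity), ← rpow_mul (by positivity),
        mul_one_div_cancel (by linarith), rpow_one]
    have e2 : FF q ε s = FF q ε s ^ (1 - 1/q) * FF q ε s ^ (1/q) := by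
      rw [← rpow_add hF]; simp
    have e3 : FF q ε s ^ (1/q) * (1/(s+ε) + 2*ε/s^2) ≤ 1 := by
      rw [e1]
      have h1 := quadratic_le_exp_of_nonneg (show 0 ≤ 2*ε/s by positivity)
      have : (s+ε) * exp (-(2*ε/s)) * (1/(s+ε) + 2*ε/s^2)
        = (1 + 2*ε/s + (2*ε/s)^2/2) * (exp (2*ε/s))⁻¹ := by
        rw [exp_neg]; field_simp; ring
      rw [this, mul_inv_le_iff₀ (exp_pos _)]; linarith
    have hp : 0 ≤ q * FF q ε s ^ (1 - 1/q) := by positivity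
    calc FF q ε s * (q * (1/(s+ε) + 2*ε/s^2))
        = (q * FF q ε s ^ (1 - 1/q)) * (FF q ε s ^ (1/q) * (1/(s+ε) + 2*ε/s^2)) := by
          nth_rewrite 1 [e2]; ring
      _ ≤ _ := mul_le_of_le_one_right hp e3

lemma FF_tendsto {q s : ℝ} (hq : 1 < q) (hs : 0 ≤ s) :
    Filter.Tendsto (fun n : ℕ => FF q (1/((n:ℝ)+1)) s) Filter.atTop (nhds (s^q)) := by
  have hn : ∀ n : ℕ, (0:ℝ) < 1/((n:ℝ)+1) := fun n => by positivity
  rcases le_or_gt s 0 with h | hs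
  · have : s = 0 := le_antisymm h hs
    subst this
    simp only [fun n : ℕ => FF_nonpos hq (hn n) h]
    rw [zero_rpow (by linarith)]; exact tendsto_const_nhds
  · simp only [fun n : ℕ => FF_pos hq (hn n) hs]
    have t := tendsto_one_div_add_atTop_nhds_zero_nat (𝕜 := ℝ)
    have c : ContinuousAt (fun ε : ℝ => (s+ε)^q * exp (-(2*q*ε/s))) 0 := by
      apply ContinuousAt.mul
      · exact (by fun_prop : ContinuousAt (fun ε : ℝ => s+ε) 0).rpow_const (Or.inl (by simp; linarith))
      · fun_prop
    have := c.tendsto.comp t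
    simpa [Function.comp_def] using this
section aux
variable {N : ℕ}

noncomputable def DD (v : EuclideanSpace ℝ (Fin N) × ℝ) (Φ : EuclideanSpace ℝ (Fin N) × ℝ → ℝ) :
    EuclideanSpace ℝ (Fin N) × ℝ → ℝ := fun z => fderiv ℝ Φ z v

noncomputable def LL (Φ : EuclideanSpace ℝ (Fin N) × ℝ → ℝ) (z : EuclideanSpace ℝ (Fin N) × ℝ) : ℝ :=
  -(DD (0,1) Φ z) - ∑ i : Fin N, DD (EuclideanSpace.single i 1, 0) (DD (EuclideanSpace.single i 1, 0) Φ) z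

lemma DD_contDiff (v : EuclideanSpace ℝ (Fin N) × ℝ) {Φ : EuclideanSpace ℝ (Fin N) × ℝ → ℝ}
    (h : ContDiff ℝ (⊤ : ℕ∞) Φ) : ContDiff ℝ (⊤ : ℕ∞) (DD v Φ) := by
  unfold DD
  exact (h.fderiv_right (m := (⊤ : ℕ∞)) (by simp)).clm_apply contDiff_const

lemma DD_zero (v : EuclideanSpace ℝ (Fin N) × ℝ) {Φ : EuclideanSpace ℝ (Fin N) × ℝ → ℝ} :
    tsupport (DD v Φ) ⊆ tsupport Φ := by
  refine (closure_mono ?_).trans (tsupport_fderiv_subset ℝ (f := Φ) )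
  intro z hz h
  apply hz
  simp [DD, h]

lemma LL_cont {Φ : EuclideanSpace ℝ (Fin N) × ℝ → ℝ}
    (h : ContDiff ℝ (⊤ : ℕ∞) Φ) : Continuous (LL Φ) := by
  unfold LL
  refine (DD_contDiff _ h).continuous.neg.sub (continuous_finsetSum _ fun i _ => ?_)
  exact (DD_contDiff _ (DD_contDiff _ h)).continuous

lemma LL_zero {Φ : EuclideanSpace ℝ (Fin N) × ℝ → ℝ} {z} (hz : z ∉ tsupport Φ) : LL Φ z = 0 := by
  unfold LL
  have h1 : ∀ v, DD v Φ z = 0 := fun v => image_eq_zero_of_notMem_tsupport fun h => hz (DD_zero v h)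
  have h2 : ∀ v, DD v (DD v Φ) z = 0 := fun v =>
    image_eq_zero_of_notMem_tsupport fun h => hz (DD_zero v (DD_zero v h))
  simp [h1, h2]

lemma LL_eq {φ : EuclideanSpace ℝ (Fin N) → ℝ → ℝ}
    (h : ContDiff ℝ (⊤ : ℕ∞) (Function.uncurry φ)) (x : EuclideanSpace ℝ (Fin N)) (t : ℝ) :
    -(deriv (φ x) t) - euclLap N (fun y => φ y t) x = LL (Function.uncurry φ) (x,t) := by
  unfold LL euclLap
  have hd : Differentiable ℝ (Function.uncurry φ) := h.differentiable (by simp)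
  have e1 : deriv (φ x) t = DD (0,1) (Function.uncurry φ) (x,t) := by
    have c : HasDerivAt (fun s : ℝ => (x, s)) ((0:EuclideanSpace ℝ (Fin N)),(1:ℝ)) t :=
      (hasDerivAt_const t x).prodMk (hasDerivAt_id t)
    exact ((hd (x,t)).hasFDerivAt.comp_hasDerivAt t c).deriv
  have sl : ∀ (Ψ : EuclideanSpace ℝ (Fin N) × ℝ → ℝ), Differentiable ℝ Ψ → ∀ y v,
      fderiv ℝ (fun y => Ψ (y,t)) y v = DD (v,0) Ψ (y,t) := by
    intro Ψ hΨ y v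
    have c : HasFDerivAt (fun y : EuclideanSpace ℝ (Fin N) => (y, t))
      ((ContinuousLinearMap.id ℝ _).prod 0) y := (hasFDerivAt_id y).prodMk (hasFDerivAt_const t y)
    have := ((hΨ (y,t)).hasFDerivAt.comp y c).fderiv
    have h2 : fderiv ℝ (fun y => Ψ (y,t)) y = _ := this
    rw [h2]; simp [DD]
  rw [e1]
  congr 1
  refine Finset.sum_congr rfl fun i _ => ?_
  rw [iteratedFDeriv_two_apply]
  simp only [Matrix.cons_val_zero, Matrix.cons_val_one]
  set v : EuclideanSpace ℝ (Fin N) := EuclideanSpace.single i 1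
  have hs : ContDiff ℝ (⊤ : ℕ∞) (fun y => φ y t) := h.comp (contDiff_id.prodMk contDiff_const)
  have hs' : Differentiable ℝ (fderiv ℝ (fun y => φ y t)) :=
    (hs.fderiv_right (m := (⊤ : ℕ∞)) (by simp)).differentiable (by simp)
  have : fderiv ℝ (fderiv ℝ (fun y => φ y t)) x v v
      = fderiv ℝ (fun y => fderiv ℝ (fun y => φ y t) y v) x v := by
    rw [fderiv_clm_apply (hs' x) (differentiableAt_const v)]
    simp
  rw [this]
  have h3 : (fun y => fderiv ℝ (fun y => φ y t) y v)
      = fun y => DD (v,0) (Function.uncurry φ) (y,t) := by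
    funext y; exact sl (Function.uncurry φ) hd y v
  rw [h3]
  exact sl _ ((DD_contDiff _ h).differentiable (by simp)) x v

lemma DD_comp {F : ℝ → ℝ} (hF : ContDiff ℝ (⊤ : ℕ∞) F) {Φ : EuclideanSpace ℝ (Fin N) × ℝ → ℝ}
    (h : ContDiff ℝ (⊤ : ℕ∞) Φ) (v z) :
    DD v (fun z => F (Φ z)) z = deriv F (Φ z) * DD v Φ z := by
  have h1 := ((hF.differentiable (by simp) (Φ z)).hasDerivAt.comp_hasFDerivAt z
    (h.differentiable (by simp) z).hasFDerivAt).fderiv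
  have h2 : fderiv ℝ (fun z => F (Φ z)) z = _ := h1
  unfold DD
  rw [h2]; simp

lemma LL_comp_le {F : ℝ → ℝ} (hF : ContDiff ℝ (⊤ : ℕ∞) F) (h2 : ∀ s, 0 ≤ deriv (deriv F) s)
    {Φ : EuclideanSpace ℝ (Fin N) × ℝ → ℝ}
    (h : ContDiff ℝ (⊤ : ℕ∞) Φ) (z) :
    LL (fun z => F (Φ z)) z ≤ deriv F (Φ z) * LL Φ z := by
  have hF' : ContDiff ℝ (⊤ : ℕ∞) (deriv F) := ((contDiff_infty_iff_deriv (𝕜 := ℝ)).1 hF).2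
  have key : ∀ v, deriv F (Φ z) * DD v (DD v Φ) z ≤ DD v (DD v (fun z => F (Φ z))) z := by
    intro v
    have e : DD v (fun z => F (Φ z)) = fun z => deriv F (Φ z) * DD v Φ z := by
      funext z; exact DD_comp hF h v z
    have e2 : DD v (fun z => deriv F (Φ z) * DD v Φ z) z =
        deriv F (Φ z) * DD v (DD v Φ) z + DD v Φ z * DD v (fun z => deriv F (Φ z)) z := by
      have := fderiv_fun_mul ((hF'.comp h).differentiable (by simp) z)
        ((DD_contDiff v h).differentiable (by simp) z)
      have h3 : fderiv ℝ (fun z => deriv F (Φ z) * DD v Φ z) z = _ := this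
      show fderiv ℝ (fun z => deriv F (Φ z) * DD v Φ z) z v = _
      rw [h3]; simp [DD]; left; rfl
    rw [e, e2, DD_comp hF' h]
    have := mul_nonneg (h2 (Φ z)) (sq_nonneg (DD v Φ z))
    nlinarith
  unfold LL
  rw [DD_comp hF h, mul_sub, Finset.mul_sum]
  have := Finset.sum_le_sum (s := Finset.univ) fun i _ =>
    key ((EuclideanSpace.single i 1 : EuclideanSpace ℝ (Fin N)), 0)
  linarith

end aux

section aux2
variable {N : ℕ}

lemma int_aux {Φ g c : EuclideanSpace ℝ (Fin N) × ℝ → ℝ} (hΦ : HasCompactSupport Φ) {I : Set ℝ}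
    (hI : MeasurableSet I)
    (hg : IntegrableOn g ((Prod.fst '' tsupport Φ) ×ˢ I)) (hc : Continuous c)
    (hz : ∀ z, z ∉ tsupport Φ → c z = 0) :
    IntegrableOn (fun z => g z * c z) (univ ×ˢ I) := by
  have hcs : HasCompactSupport c := HasCompactSupport.intro hΦ hz
  obtain ⟨M, hM⟩ := hcs.exists_bound_of_continuous hc
  have h1 : IntegrableOn (fun z => g z * c z) ((Prod.fst '' tsupport Φ) ×ˢ I) :=
    Integrable.mul_bdd hg hc.aestronglyMeasurable (Filter.Eventually.of_forall hM)
  refine h1.of_forall_diff_eq_zero (MeasurableSet.univ.prod hI) ?_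
  rintro ⟨x, t⟩ ⟨h2, h3⟩
  have : c (x,t) = 0 := hz _ fun h => h3 ⟨⟨_, h, rfl⟩, h2.2⟩
  simp [this]

lemma iter_aux {f : EuclideanSpace ℝ (Fin N) × ℝ → ℝ} {I : Set ℝ}
    (hf : IntegrableOn f (univ ×ˢ I)) :
    ∫ t in I, ∫ x, f (x,t) = ∫ z in univ ×ˢ I, f z := by
  have e : (volume : Measure (EuclideanSpace ℝ (Fin N) × ℝ)).restrict (univ ×ˢ I)
      = volume.prod (volume.restrict I) := by
    rw [Measure.volume_eq_prod, ← Measure.prod_restrict, Measure.restrict_univ]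
  unfold IntegrableOn at hf
  rw [e] at hf ⊢
  exact (integral_prod_symm f hf).symm

lemma main_aux {p q : ℝ} (hpq : p.HolderConjugate q) {ε T τ : ℝ} (hε : 0 < ε)
    {μ : Measure (EuclideanSpace ℝ (Fin N))}
    {u : EuclideanSpace ℝ (Fin N) → ℝ → ℝ} (hu : IsVeryWeakSupersolutionHeat N p T μ u)
    (hτ : τ ∈ Ioo 0 T) {φ : EuclideanSpace ℝ (Fin N) → ℝ → ℝ}
    (h1 : ContDiff ℝ (⊤ : ℕ∞) (Function.uncurry φ))
    (h2 : HasCompactSupport (Function.uncurry φ))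
    (h4 : ∀ x, φ x τ = 0) :
    ∫ x, FF q ε (φ x 0) ∂μ ≤
      q ^ q * ∫ z in tsupport (Function.uncurry φ), |LL (Function.uncurry φ) z| ^ q := by
  have hq : 1 < q := hpq.symm.lt
  have hp : 1 < p := hpq.lt
  obtain ⟨-, u0, ui, uw⟩ := hu
  set Φ := Function.uncurry φ with hΦ
  have hF := FF_contDiff hq hε
  set Ψ : EuclideanSpace ℝ (Fin N) × ℝ → ℝ := fun z => FF q ε (Φ z) with hΨ
  have hΨc : ContDiff ℝ (⊤ : ℕ∞) Ψ := hF.comp h1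
  have hΨz : ∀ z, z ∉ tsupport Φ → Ψ z = 0 := fun z hz => by
    simp only [hΨ]
    rw [image_eq_zero_of_notMem_tsupport hz, FF_nonpos hq hε le_rfl]
  have hts : tsupport Ψ ⊆ tsupport Φ := by
    apply closure_minimal _ (isClosed_tsupport _)
    intro z hz
    by_contra h
    exact hz (hΨz z h)
  have w := uw τ hτ (fun x t => FF q ε (φ x t)) hΨc (HasCompactSupport.intro h2 hΨz)
    (fun x t => FF_nonneg hq hε _) (fun x => by rw [h4, FF_nonpos hq hε le_rfl])
  have e1 : ∀ x t, -(deriv (fun t => FF q ε (φ x t)) t) - euclLap N (fun y => FF q ε (φ y t)) x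
      = LL Ψ (x,t) := fun x t => LL_eq (φ := fun x t => FF q ε (φ x t)) hΨc x t
  simp only [e1] at w
  have hK : IsCompact (Prod.fst '' tsupport Φ) := h2.isCompact.image continuous_fst
  obtain ⟨i1, i2⟩ := ui _ hK τ hτ
  have j1 := int_aux h2 measurableSet_Ioo i1 (LL_cont hΨc) (fun z hz => LL_zero fun h => hz (hts h))
  have j2 := int_aux h2 measurableSet_Ioo i2 hΨc.continuous hΨz
  have k1 := iter_aux j1
  have k2 := iter_aux j2
  have k1' : ∫ t in Ioo (0:ℝ) τ, ∫ x, u x t * LL Ψ (x,t) = _ := k1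
  have k2' : ∫ t in Ioo (0:ℝ) τ, ∫ x, u x t ^ p * FF q ε (φ x t) = _ := k2
  rw [k1', k2'] at w
  set R : EuclideanSpace ℝ (Fin N) × ℝ → ℝ := fun z => |LL Φ z| ^ q with hR
  have Rc : Continuous R := (LL_cont h1).abs.rpow_const (fun _ => Or.inr (by linarith))
  have Rz : ∀ z, z ∉ tsupport Φ → R z = 0 := fun z hz => by
    simp only [hR]
    rw [LL_zero hz, abs_zero, zero_rpow (by linarith)]
  have Ri : Integrable R := Rc.integrable_of_hasCompactSupport (HasCompactSupport.intro h2 Rz)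
  have R0 : ∀ z, 0 ≤ R z := fun z => by simp only [hR]; positivity
  have eR : ∫ z in tsupport Φ, R z = ∫ z, R z :=
    setIntegral_eq_integral_of_forall_compl_eq_zero Rz
  rw [eR]
  have hmono : (∫ z in univ ×ˢ Ioo (0:ℝ) τ, Function.uncurry u z * LL Ψ z)
      ≤ ∫ z in univ ×ˢ Ioo (0:ℝ) τ, (u z.1 z.2 ^ p * Ψ z + q ^ q * R z) := by
    refine setIntegral_mono_on j1 (j2.add (Ri.integrableOn.const_mul _))
      (MeasurableSet.univ.prod measurableSet_Ioo) ?_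
    rintro ⟨x, t⟩ ⟨-, ht⟩
    have hu0 : 0 ≤ u x t := u0 x t ⟨ht.1, ht.2.trans hτ.2⟩
    have a1 : LL Ψ (x,t) ≤ deriv (FF q ε) (Φ (x,t)) * LL Φ (x,t) :=
      LL_comp_le hF (FF_deriv2 hq hε) h1 (x,t)
    have F0 := FF_nonneg hq hε (Φ (x,t))
    have a2 : LL Ψ (x,t) ≤ (q * (FF q ε (Φ (x,t))) ^ (1/p)) * |LL Φ (x,t)| := by
      refine a1.trans ?_
      have : 1/p = 1 - 1/q := by
        have := hpq.inv_add_inv_eq_one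
        simp only [one_div]; linarith
      rw [this]
      exact (mul_le_mul_of_nonneg_left (le_abs_self _) (FF_deriv_nonneg hq hε _)).trans
        (mul_le_mul_of_nonneg_right (FF_deriv_le hq hε _) (abs_nonneg _))
    have y := young_inequality_of_nonneg (a := u x t * (FF q ε (Φ (x,t))) ^ (1/p))
      (b := q * |LL Φ (x,t)|) (by positivity) (by positivity) hpq
    rw [mul_rpow hu0 (by positivity), ← rpow_mul F0, one_div_mul_cancel (by linarith), rpow_one,
      mul_rpow (by linarith) (abs_nonneg _)] at y
    have y1 : u x t ^ p * FF q ε (Φ (x,t)) / p ≤ u x t ^ p * FF q ε (Φ (x,t)) :=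
      div_le_self (by positivity) hp.le
    have y2 : q ^ q * |LL Φ (x,t)| ^ q / q ≤ q ^ q * |LL Φ (x,t)| ^ q :=
      div_le_self (by positivity) hq.le
    have a3 := mul_le_mul_of_nonneg_left a2 hu0
    show u x t * LL Ψ (x,t) ≤ u x t ^ p * FF q ε (Φ (x,t)) + q ^ q * |LL Φ (x,t)| ^ q
    calc _ ≤ _ := a3
      _ = _ := by ring
      _ ≤ _ := y
      _ ≤ _ := add_le_add y1 y2
  rw [integral_add j2 (Ri.integrableOn.const_mul _), integral_const_mul] at hmono
  have hle : ∫ z in univ ×ˢ Ioo (0:ℝ) τ, R z ≤ ∫ z, R z :=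
    setIntegral_le_integral Ri (Filter.Eventually.of_forall R0)
  have := mul_le_mul_of_nonneg_left hle (show 0 ≤ q ^ q by positivity)
  linarith

end aux2

/-- The basic test-function inequality (Lemma 2.1) for very weak supersolutions of the
semilinear heat equation `∂_t u - Δu = u^p`. -/
theorem stmt_7 (N : ℕ) (hN : 1 ≤ N) (p : ℝ) (hp : 1 < p) :
    ∃ C : ℝ, 0 < C ∧ ∀ T : ℝ, 0 < T →
      ∀ μ : Measure (EuclideanSpace ℝ (Fin N)), IsFiniteMeasureOnCompacts μ →
      (∃ u, IsVeryWeakSupersolutionHeat N p T μ u) →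
      ∀ τ ∈ Set.Ioo (0:ℝ) T, ∀ φ : EuclideanSpace ℝ (Fin N) → ℝ → ℝ,
        ContDiff ℝ (⊤ : ℕ∞) (Function.uncurry φ) →
        HasCompactSupport (Function.uncurry φ) →
        (∀ x t, 0 ≤ φ x t) →
        (∀ x, φ x τ = 0) →
        (∫ x, φ x 0 ^ (p/(p-1)) ∂μ) ≤
          C * ∫ q in tsupport (Function.uncurry φ),
            |(-(deriv (φ q.1) q.2) - euclLap N (fun y => φ y q.2) q.1)| ^ (p/(p-1)) := by
  have hpq : p.HolderConjugate (p/(p-1)) := Real.HolderConjugate.conjExponent hp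
  set q := p/(p-1) with hqd
  have hq : 1 < q := hpq.symm.lt
  refine ⟨q ^ q, by positivity, ?_⟩
  rintro T - μ hμ ⟨u, hu⟩ τ hτ φ h1 h2 h3 h4
  simp only [fun z : EuclideanSpace ℝ (Fin N) × ℝ => LL_eq h1 z.1 z.2]
  have hc : Continuous fun x => φ x 0 :=
    h1.continuous.comp (continuous_id.prodMk continuous_const)
  have hcq : Continuous fun x => φ x 0 ^ q := hc.rpow_const (fun _ => Or.inr (by linarith))
  have hcs : HasCompactSupport fun x => φ x 0 ^ q := by
    refine HasCompactSupport.intro (h2.isCompact.image continuous_fst) fun x hx => ?_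
    have : φ x 0 = 0 := by
      have : Function.uncurry φ (x,0) = 0 :=
        image_eq_zero_of_notMem_tsupport fun h => hx ⟨_, h, rfl⟩
      exact this
    simp only [this]; exact zero_rpow (by linarith)
  have hn : ∀ n : ℕ, (0:ℝ) < 1/((n:ℝ)+1) := fun n => by positivity
  have lim : Filter.Tendsto (fun n : ℕ => ∫ x, FF q (1/((n:ℝ)+1)) (φ x 0) ∂μ) Filter.atTop
      (nhds (∫ x, φ x 0 ^ q ∂μ)) := by
    refine tendsto_integral_of_dominated_convergence (fun x => φ x 0 ^ q) ?_
      (hcq.integrable_of_hasCompactSupport hcs) ?_ ?_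
    · intro n
      exact ((FF_contDiff hq (hn n)).continuous.comp hc).aestronglyMeasurable
    · intro n
      refine Filter.Eventually.of_forall fun x => ?_
      rw [norm_of_nonneg (FF_nonneg hq (hn n) _)]
      exact FF_le hq (hn n) (h3 x 0)
    · exact Filter.Eventually.of_forall fun x => FF_tendsto hq (h3 x 0)
  refine le_of_tendsto' lim fun n => ?_
  exact main_aux hpq (hn n) hu hτ h1 h2 h4
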